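/- arXiv:math/9906202 — 5 statements merged into one kernel-verified Lean document; each statement's English description precedes it below -/
import Mathlib

section
/- The determinant is conserved along the flow of the system (5) starting on SL(2,ℂ): let F : ℝ → ℝ be continuous and let a : ℝ → M₂(ℂ) be a differentiable curve of 2×2 complex matrices satisfying ȧ(t) = −(i/2) F(t) ( H(t)·a(t) + J·conj(a(t))·J ), where H(t) = (1/2)·Tr(a(t)·a(t)*) and conj denotes entrywise complex conjugation. If det a(0) = 1, then det a(t) = 1 for all t. (Along such a curve, det a satisfies d/dt (det a) = −i F H (det a − 1).) -/
open Matrix Complex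

/-- The matrix `J = [[0, -1],[1, 0]]`. -/
def matJ : Matrix (Fin 2) (Fin 2) ℂ := !![0, -1; 1, 0]

lemma matJ_mul_mul_matJ (b : Matrix (Fin 2) (Fin 2) ℂ) :
    matJ * b * matJ = !![-b 1 1, b 1 0; b 0 1, -b 0 0] := by
  ext i j
  fin_cases i <;> fin_cases j <;> simp [matJ, Matrix.vecMul, dotProduct, Matrix.mul_apply]

/-- A solution of `u' = c u` with `c` purely imaginary that vanishes at `0` vanishes everywhere. -/
lemma eq_zero_of_hasDerivAt_mul_of_star_eq_neg {c u : ℝ → ℂ} (hc : ∀ t, star (c t) = -c t)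
    (hu : ∀ t, HasDerivAt u (c t * u t) t) (h0 : u 0 = 0) (t : ℝ) : u t = 0 := by
  have hd : ∀ s, HasDerivAt (fun s => u s * star (u s)) 0 s := fun s => by
    refine ((hu s).mul (hu s).star).congr_deriv ?_
    rw [star_mul, hc]
    ring
  have hconst := is_const_of_deriv_eq_zero (fun s => (hd s).differentiableAt)
    (fun s => (hd s).deriv) t 0
  simpa [h0] using hconst

/-- the determinant is conserved along the flow of the system
`ȧ = -(i/2) F (H·a + J·conj(a)·J)`, where `H = (1/2)Tr(a a*)`; moreover along such a
curve `d/dt (det a) = -i F H (det a - 1)`. -/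
theorem det_invariant_of_flow (F : ℝ → ℝ) (hF : Continuous F)
    (a : ℝ → Matrix (Fin 2) (Fin 2) ℂ) (H : ℝ → ℂ)
    (hH : ∀ t, H t = (1 / 2 : ℂ) * (a t * (a t)ᴴ).trace)
    (hode : ∀ t (i j : Fin 2), HasDerivAt (fun s => a s i j)
      (((-(Complex.I / 2) * (F t : ℂ)) •
        (H t • a t + matJ * (a t).map (starRingEnd ℂ) * matJ)) i j) t)
    (h0 : (a 0).det = 1) :
    (∀ t, (a t).det = 1) ∧
    ∀ t, HasDerivAt (fun s => (a s).det)
      (-Complex.I * (F t : ℂ) * H t * ((a t).det - 1)) t := by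
  have hH' : ∀ t, star (H t) = H t := fun t => by
    simp [hH, Matrix.trace_fin_two, Matrix.mul_apply, Fin.sum_univ_two, mul_comm]
  have hdet : ∀ t, HasDerivAt (fun s => (a s).det)
      (-Complex.I * (F t : ℂ) * H t * ((a t).det - 1)) t := fun t => by
    simp only [Matrix.det_fin_two]
    refine (((hode t 0 0).mul (hode t 1 1)).sub ((hode t 0 1).mul (hode t 1 0))).congr_deriv ?_
    have h := hH t
    simp only [Matrix.trace_fin_two, Matrix.mul_apply, Fin.sum_univ_two,
      Matrix.conjTranspose_apply, RCLike.star_def] at h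
    simp [matJ_mul_mul_matJ]
    linear_combination (-Complex.I * (F t : ℂ)) * h
  refine ⟨fun t => sub_eq_zero.mp ?_, hdet⟩
  refine eq_zero_of_hasDerivAt_mul_of_star_eq_neg (c := fun t => -Complex.I * (F t : ℂ) * H t)
    (u := fun t => (a t).det - 1) (fun t => ?_) (fun t => (hdet t).sub_const 1) (by simp [h0]) t
  rw [star_mul, hH']
  simp
  ring
end

section
/- The 'free Hamiltonian' H₀ is a constant of the motion for the system (5) on SL(2,ℂ): let F : ℝ → ℝ be continuous and let a : ℝ → M₂(ℂ) be a differentiable curve satisfying ȧ(t) = −(i/2) F(t) ( H(t)·a(t) + J·conj(a(t))·J ), where H(t) = (1/2)·Tr(a(t)·a(t)*). If det a(t) = 1 for all t, then H(t) = H(0) for all t. -/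
open Matrix Complex

/-- the free Hamiltonian `H(t) = (1/2)Tr(a(t) a(t)*)` is a constant of the
motion for the system `ȧ = -(i/2) F (H·a + J·conj(a)·J)` on SL(2,ℂ). -/
theorem free_hamiltonian_invariant (F : ℝ → ℝ) (hF : Continuous F)
    (a : ℝ → Matrix (Fin 2) (Fin 2) ℂ) (H : ℝ → ℂ)
    (hH : ∀ t, H t = (1 / 2 : ℂ) * (a t * (a t)ᴴ).trace)
    (hode : ∀ t (i j : Fin 2), HasDerivAt (fun s => a s i j)
      (((-(Complex.I / 2) * (F t : ℂ)) •
        (H t • a t + matJ * (a t).map (starRingEnd ℂ) * matJ)) i j) t)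
    (hdet : ∀ t, (a t).det = 1) :
    ∀ t, H t = H 0 := by
  have hentries : ∀ t, H t = (1 / 2 : ℂ) *
      (a t 0 0 * star (a t 0 0) + a t 0 1 * star (a t 0 1) +
        (a t 1 0 * star (a t 1 0) + a t 1 1 * star (a t 1 1))) := fun t => by
    rw [hH t]
    simp [Matrix.trace_fin_two, Matrix.mul_apply, Fin.sum_univ_two]
  have hreal : ∀ t, star (H t) = H t := fun t => by
    rw [hentries t]
    simp only [star_mul', star_add, star_star, star_div₀, star_one, star_ofNat]
    ring
  have hderiv : ∀ t, HasDerivAt H 0 t := fun t => by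
    have hsq := fun i j => (hode t i j).mul (hode t i j).star
    have key := (((hsq 0 0).add (hsq 0 1)).add ((hsq 1 0).add (hsq 1 1))).const_mul (1 / 2 : ℂ)
    have hd := hdet t
    rw [Matrix.det_fin_two] at hd
    have hd' := congrArg star hd
    have hr := hreal t
    simp only [star_mul', star_sub, star_one] at hd'
    refine (key.congr_deriv ?_).congr_of_eventuallyEq (.of_forall hentries)
    simp [matJ, Matrix.vecMul, dotProduct, Matrix.mul_apply] at hd' hr ⊢
    rw [hr]
    linear_combination (Complex.I * F t) * (hd' - hd)
  exact fun t => is_const_of_deriv_eq_zero (fun t => (hderiv t).differentiableAt)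
    (fun t => (hderiv t).deriv) t 0
end

section
/- For every u = [[r, γ],[0, r⁻¹]] ∈ SB(2,ℂ) (r > 0, γ ∈ ℂ) one has the identity −(i/2)( H₀(u)·I + J·conj(u)·J·u⁻¹ ) = −(i/4)·[[ r² − r⁻² + |γ|² , 2γr⁻¹ ],[ 2 conj(γ) r⁻¹ , r⁻² − r² − |γ|² ]], and for every real F this matrix multiplied by F is traceless and skew-Hermitian, i.e. it lies in su(2). -/
open Matrix Complex

theorem inv_upperTriangular_fin_two {r : ℂ} (hr : r ≠ 0) (γ : ℂ) :
    (!![r, γ; 0, r⁻¹])⁻¹ = !![r⁻¹, -γ; 0, r] := by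
  rw [Matrix.inv_def]
  simp [Matrix.det_fin_two_of, Matrix.adjugate_fin_two_of, hr]

theorem matJ_mul_conj_mul_matJ (r : ℝ) (γ : ℂ) :
    matJ * (!![(r : ℂ), γ; 0, (r : ℂ)⁻¹]).map (starRingEnd ℂ) * matJ =
      !![-(r : ℂ)⁻¹, 0; (starRingEnd ℂ) γ, -(r : ℂ)] := by
  rw [Matrix.eta_fin_two (Matrix.map _ _)]
  simp [matJ]

/-- for `u = [[r, γ],[0, r⁻¹]] ∈ SB(2,ℂ)` one has
`-(i/2)(H₀(u)·I + J·conj(u)·J·u⁻¹) = -(i/4)·[[r² - r⁻² + |γ|², 2γr⁻¹],[2 conj(γ) r⁻¹, r⁻² - r² - |γ|²]]`,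
and for every real `F` this matrix times `F` is traceless and skew-Hermitian (lies in su(2)). -/
theorem legendre_matrix_eq_and_su2 (r : ℝ) (hr : 0 < r) (γ : ℂ)
    (u : Matrix (Fin 2) (Fin 2) ℂ) (hu : u = !![(r : ℂ), γ; 0, (r : ℂ)⁻¹])
    (M : Matrix (Fin 2) (Fin 2) ℂ)
    (hM : M = (-(Complex.I / 4)) •
      !![((r ^ 2 - r⁻¹ ^ 2 + Complex.normSq γ : ℝ) : ℂ), 2 * γ * (r : ℂ)⁻¹;
         2 * (starRingEnd ℂ) γ * (r : ℂ)⁻¹, ((r⁻¹ ^ 2 - r ^ 2 - Complex.normSq γ : ℝ) : ℂ)]) :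
    (-(Complex.I / 2)) •
      ((((1 / 2 : ℝ) * (Complex.normSq γ + r ^ 2 + r⁻¹ ^ 2) : ℝ) : ℂ) •
          (1 : Matrix (Fin 2) (Fin 2) ℂ) +
        matJ * u.map (starRingEnd ℂ) * matJ * u⁻¹) = M ∧
    ∀ F : ℝ, (F • M).trace = 0 ∧ (F • M)ᴴ = -(F • M) := by
  have hr' : (r : ℂ) ≠ 0 := by exact_mod_cast hr.ne'
  subst hu hM
  refine ⟨?_, fun F => ⟨?_, ?_⟩⟩
  · rw [matJ_mul_conj_mul_matJ, inv_upperTriangular_fin_two hr']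
    ext i j
    fin_cases i <;> fin_cases j <;>
      simp [Complex.normSq_eq_conj_mul_self] <;> ring
  · simp [Matrix.trace_fin_two]
    ring
  · ext i j
    fin_cases i <;> fin_cases j <;>
      simp [Complex.normSq_eq_conj_mul_self] <;> ring
end

section
/- The 'Legendre transform' of the isotropic system (F = 1) on the double group SL(2,ℂ) is invertible: the map Φ from {(r, γ) : r ∈ ℝ, r > 0, γ ∈ ℂ} to ℝ × ℂ defined by Φ(r, γ) = ( (1/2)(r² − r⁻² + |γ|²), γ/r ) is a bijection. -/
open Complex

/-- For `a > 0`, the function `r ↦ a r² - r⁻²` is strictly increasing on the positive reals. -/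
theorem strictMonoOn_mul_sq_sub_inv_sq {a : ℝ} (ha : 0 < a) :
    StrictMonoOn (fun r : ℝ => a * r ^ 2 - r⁻¹ ^ 2) (Set.Ioi 0) := by
  intro r hr t _ hrt
  have hr : 0 < r := hr
  have h₁ : a * r ^ 2 < a * t ^ 2 := by gcongr
  have h₂ : t⁻¹ ^ 2 < r⁻¹ ^ 2 := by
    have : 0 < t := hr.trans hrt
    gcongr
  exact sub_lt_sub h₁ h₂

/-- For `a > 0`, the function `r ↦ a r² - r⁻²` maps the positive reals onto `ℝ`. -/
theorem exists_pos_mul_sq_sub_inv_sq_eq {a : ℝ} (ha : 0 < a) (s : ℝ) :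
    ∃ r : ℝ, 0 < r ∧ a * r ^ 2 - r⁻¹ ^ 2 = 2 * s := by
  have hsq : √(s ^ 2 + a) ^ 2 = s ^ 2 + a := Real.sq_sqrt (by positivity)
  have hpos : 0 < s + √(s ^ 2 + a) := by
    have h : |s| < √(s ^ 2 + a) := by
      rw [← Real.sqrt_sq_eq_abs]
      exact Real.sqrt_lt_sqrt (sq_nonneg s) (by linarith)
    linarith [neg_abs_le s]
  set d := √(s ^ 2 + a)
  have hx : 0 < (s + d) / a := div_pos hpos ha
  refine ⟨√((s + d) / a), Real.sqrt_pos.2 hx, ?_⟩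
  rw [inv_pow, Real.sq_sqrt hx.le]
  field_simp
  linear_combination hsq

/-- the Legendre transform of the isotropic system (F = 1) on the double
group SL(2,ℂ), `Φ(r, γ) = ((1/2)(r² - r⁻² + |γ|²), γ/r)`, is a bijection from
`{(r, γ) : r > 0, γ ∈ ℂ}` onto `ℝ × ℂ`. -/
theorem legendre_transform_bijective :
    Function.Bijective (fun p : { q : ℝ × ℂ // 0 < q.1 } =>
      (((1 / 2 : ℝ) * (p.1.1 ^ 2 - (p.1.1)⁻¹ ^ 2 + Complex.normSq p.1.2),
        p.1.2 / (p.1.1 : ℂ)) : ℝ × ℂ)) := by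
  have ha (w : ℂ) : 0 < 1 + normSq w := by linarith [normSq_nonneg w]
  constructor
  · rintro ⟨⟨r, γ⟩, hr⟩ ⟨⟨t, δ⟩, ht⟩ h
    obtain ⟨h₁, h₂⟩ := Prod.mk.inj h
    dsimp only at hr ht h₁ h₂
    have hr' : (r : ℂ) ≠ 0 := ofReal_ne_zero.2 hr.ne'
    have ht' : (t : ℂ) ≠ 0 := ofReal_ne_zero.2 ht.ne'
    obtain ⟨w, hw⟩ : ∃ w, w = γ / (r : ℂ) := ⟨_, rfl⟩
    have hγ : γ = w * r := by rw [hw, div_mul_cancel₀ _ hr']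
    have hδ : δ = w * t := by rw [hw, h₂, div_mul_cancel₀ _ ht']
    rw [hγ, hδ, normSq_mul, normSq_mul, normSq_ofReal, normSq_ofReal] at h₁
    have hrt : r = t := (strictMonoOn_mul_sq_sub_inv_sq (ha w)).injOn hr ht (by
      linear_combination 2 * h₁)
    subst hrt
    rw [Subtype.mk.injEq, hγ, hδ]
  · rintro ⟨s, w⟩
    obtain ⟨r, hr, h⟩ := exists_pos_mul_sq_sub_inv_sq_eq (ha w) s
    refine ⟨⟨(r, w * r), hr⟩, Prod.ext ?_ ?_⟩
    · dsimp only
      rw [normSq_mul, normSq_ofReal]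
      linear_combination h / 2
    · exact mul_div_cancel_right₀ _ (ofReal_ne_zero.2 hr.ne')
end

section
/- Explicit solution of the momentum dynamics in Example 4: let ν₀ ∈ ℂ with ν₀ ≠ 0, α₀ ∈ ℂ, u₀ ∈ SB(2,ℂ), and set c = (Re ν₀ + Im ν₀)/|ν₀|². Then the curve u(t) = [[1, conj(α₀)·c·(exp(−(i/2)|ν₀|²t) − 1)],[0, 1]] · u₀ satisfies u(0) = u₀, u(t) ∈ SB(2,ℂ) for all t (with the same diagonal entries as u₀), and solves u̇(t)·u(t)⁻¹ = −(i/2)·conj(α(t))·(Re ν₀ + Im ν₀)·[[0, 1],[0, 0]], where α(t) = α₀·exp((i/2)|ν₀|²t). -/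
open Matrix Complex

/-- Membership in SB(2,ℂ): matrices `[[r, γ],[0, r⁻¹]]` with `r > 0` real, `γ ∈ ℂ`. -/
def IsSB2 (u : Matrix (Fin 2) (Fin 2) ℂ) : Prop :=
  ∃ (r : ℝ) (γ : ℂ), 0 < r ∧ u = !![(r : ℂ), γ; 0, (r : ℂ)⁻¹]

/-- explicit solution of the momentum dynamics in Example 4. With
`c = (Re ν₀ + Im ν₀)/|ν₀|²` and `α(t) = α₀ exp((i/2)|ν₀|² t)`, the curve
`u(t) = [[1, conj(α₀)·c·(exp(-(i/2)|ν₀|²t) - 1)],[0, 1]] · u₀` satisfies `u 0 = u₀`,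
stays in SB(2,ℂ) with the same diagonal entries as `u₀`, and solves
`u̇·u⁻¹ = -(i/2)·conj(α(t))·(Re ν₀ + Im ν₀)·[[0,1],[0,0]]`. -/
theorem momentum_dynamics_example4 (ν₀ : ℂ) (hν₀ : ν₀ ≠ 0) (α₀ : ℂ)
    (u₀ : Matrix (Fin 2) (Fin 2) ℂ) (hu₀ : IsSB2 u₀)
    (c : ℝ) (hc : c = (ν₀.re + ν₀.im) / Complex.normSq ν₀)
    (α : ℝ → ℂ)
    (hα : ∀ t : ℝ, α t = α₀ * Complex.exp ((Complex.I / 2) * (Complex.normSq ν₀ : ℂ) * t))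
    (u : ℝ → Matrix (Fin 2) (Fin 2) ℂ)
    (hu : ∀ t : ℝ, u t =
      !![1, (starRingEnd ℂ) α₀ * (c : ℂ) *
            (Complex.exp (-(Complex.I / 2) * (Complex.normSq ν₀ : ℂ) * t) - 1);
         0, 1] * u₀) :
    u 0 = u₀ ∧
    (∀ t, IsSB2 (u t) ∧ u t 0 0 = u₀ 0 0 ∧ u t 1 1 = u₀ 1 1) ∧
    ∀ t (i j : Fin 2), HasDerivAt (fun s => u s i j)
      ((((-(Complex.I / 2) * (starRingEnd ℂ) (α t) * ((ν₀.re + ν₀.im : ℝ) : ℂ)) •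
          (!![0, 1; 0, 0] : Matrix (Fin 2) (Fin 2) ℂ)) * u t) i j) t := by
  obtain ⟨r, γ, hr, rfl⟩ := hu₀
  have hN : (Complex.normSq ν₀ : ℂ) ≠ 0 := by
    exact_mod_cast mt Complex.normSq_eq_zero.mp hν₀
  have hcN : (c : ℂ) * (Complex.normSq ν₀ : ℂ) = ((ν₀.re + ν₀.im : ℝ) : ℂ) := by
    rw [hc]
    push_cast
    field_simp
  have hconj : ∀ t : ℝ, (starRingEnd ℂ) (α t) = (starRingEnd ℂ) α₀ *
      Complex.exp (-(Complex.I / 2) * (Complex.normSq ν₀ : ℂ) * t) := by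
    intro t
    rw [hα, map_mul, ← Complex.exp_conj]
    simp [neg_div, map_ofNat]
  have hentry : ∀ t : ℝ, u t = !![(r : ℂ), γ + (starRingEnd ℂ) α₀ * (c : ℂ) *
      (Complex.exp (-(Complex.I / 2) * (Complex.normSq ν₀ : ℂ) * t) - 1) * (r : ℂ)⁻¹;
      0, (r : ℂ)⁻¹] := by
    intro t
    rw [hu]
    ext i j
    fin_cases i <;> fin_cases j <;> simp [Matrix.mul_apply, Fin.sum_univ_two]
  refine ⟨?_, fun t => ⟨⟨r, _, hr, hentry t⟩, ?_, ?_⟩, fun t i j => ?_⟩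
  · rw [hentry]
    simp
  · simp [hentry]
  · simp [hentry]
  · have hexp : HasDerivAt
        (fun s : ℝ => Complex.exp (-(Complex.I / 2) * (Complex.normSq ν₀ : ℂ) * s))
        (Complex.exp (-(Complex.I / 2) * (Complex.normSq ν₀ : ℂ) * t) *
          (-(Complex.I / 2) * (Complex.normSq ν₀ : ℂ) * 1)) t :=
      ((hasDerivAt_id t).ofReal_comp.const_mul _).cexp
    have hoffDiag := (((hexp.sub_const 1).const_mul
      ((starRingEnd ℂ) α₀ * (c : ℂ))).mul_const (r : ℂ)⁻¹).const_add γ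
    simp only [hentry, hconj, ← hcN]
    fin_cases i <;> fin_cases j
    · simpa [Matrix.mul_apply, Fin.sum_univ_two] using hasDerivAt_const t (r : ℂ)
    · refine hoffDiag.congr_deriv ?_
      simp [Matrix.mul_apply, Fin.sum_univ_two]
      exact Or.inl (by ring)
    · simpa [Matrix.mul_apply, Fin.sum_univ_two] using hasDerivAt_const t (0 : ℂ)
    · simpa [Matrix.mul_apply, Fin.sum_univ_two] using hasDerivAt_const t (r : ℂ)⁻¹
end
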